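/- Let X be a finite set and let R be an essential relation on X. Then there exists a positive integer m such that the m-fold composition R^m (composition of correspondences iterated m times) is a preorder on X, i.e., R^m is reflexive and transitive. -/

import Mathlib

/-- Composition of correspondences: `RS = {(x,z) : ∃ y, (x,y) ∈ R ∧ (y,z) ∈ S}`. -/
def CorrRel.comp {X Y Z : Type*} (R : Set (X × Y)) (S : Set (Y × Z)) : Set (X × Z) :=
  {p | ∃ y, (p.1, y) ∈ R ∧ (y, p.2) ∈ S}

/-- A relation on a finite set `X` is inessential if it factorizes through a set of
cardinality strictly smaller than `|X|`. -/
def CorrRel.Inessential {X : Type*} [Fintype X] (R : Set (X × X)) : Prop :=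
  ∃ m : ℕ, m < Fintype.card X ∧
    ∃ (S : Set (X × Fin m)) (T : Set (Fin m × X)), R = CorrRel.comp S T

/-- A relation is essential if it is not inessential. -/
def CorrRel.Essential {X : Type*} [Fintype X] (R : Set (X × X)) : Prop :=
  ¬ CorrRel.Inessential R

/-- The diagonal `Δ = {(x,x) : x ∈ X}`. -/
def CorrRel.diag (X : Type*) : Set (X × X) := {p | p.1 = p.2}

/-- The permutation relation `Δ_σ = {(σ x, x) : x ∈ X}`. -/
def CorrRel.deltaPerm {X : Type*} (σ : Equiv.Perm X) : Set (X × X) :=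
  {p | p.1 = σ p.2}

/-- The m-fold iterated composition of a relation with itself. -/
def CorrRel.compPow {X : Type*} (R : Set (X × X)) : ℕ → Set (X × X)
  | 0 => CorrRel.diag X
  | n + 1 => CorrRel.comp (CorrRel.compPow R n) R

/-- A relation factoring through a finite type of smaller cardinality is inessential. -/
theorem CorrRel.Inessential.of_comp {X Y : Type*} [Fintype X] [Fintype Y] {R : Set (X × X)}
    (h : Fintype.card Y < Fintype.card X) (S : Set (X × Y)) (T : Set (Y × X))
    (hR : ∀ x z, (x, z) ∈ R ↔ ∃ y, (x, y) ∈ S ∧ (y, z) ∈ T) : CorrRel.Inessential R := by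
  let e := Fintype.equivFin Y
  refine ⟨Fintype.card Y, h, {p | (p.1, e.symm p.2) ∈ S}, {p | (e.symm p.1, p.2) ∈ T}, ?_⟩
  ext ⟨x, z⟩
  rw [hR]
  exact e.symm.surjective.exists

/-- An essential relation contains the graph of a permutation, by Hall's marriage theorem. -/
theorem CorrRel.Essential.exists_perm {X : Type*} [Fintype X] {R : Set (X × X)}
    (hR : CorrRel.Essential R) : ∃ σ : Equiv.Perm X, ∀ x, (x, σ x) ∈ R := by
  classical
  let t : X → Finset X := fun x => {y | (x, y) ∈ R}
  have hall : ∀ A : Finset X, A.card ≤ (A.biUnion t).card := by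
    intro A
    by_contra! hA
    refine hR (.of_comp (Y := {x // x ∈ Aᶜ} ⊕ {y // y ∈ A.biUnion t}) ?_
      {p | p.2.elim (fun a => p.1 = a.1) (fun b => p.1 ∈ A ∧ (p.1, b.1) ∈ R)}
      {p | p.1.elim (fun a => (a.1, p.2) ∈ R) (fun b => b.1 = p.2)} fun x z => ?_)
    · have := Finset.card_add_card_compl A
      rw [Fintype.card_sum, Fintype.card_coe, Fintype.card_coe]
      omega
    · constructor
      · intro h
        by_cases hx : x ∈ A
        · exact ⟨.inr ⟨z, Finset.mem_biUnion.2 ⟨x, hx, by simpa [t] using h⟩⟩, ⟨hx, h⟩, rfl⟩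
        · exact ⟨.inl ⟨x, Finset.mem_compl.2 hx⟩, rfl, h⟩
      · rintro ⟨a | b, hS, hT⟩
        · obtain rfl : x = a.1 := hS
          exact hT
        · obtain rfl : b.1 = z := hT
          exact hS.2
  obtain ⟨f, hf, hft⟩ := (Finset.all_card_le_biUnion_card_iff_exists_injective t).1 hall
  exact ⟨.ofBijective f (Finite.injective_iff_bijective.1 hf), fun x => by simpa [t] using hft x⟩

theorem CorrRel.mem_compPow_add {X : Type*} (R : Set (X × X)) (m n : ℕ) (x z : X) :
    (x, z) ∈ CorrRel.compPow R (m + n) ↔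
      ∃ y, (x, y) ∈ CorrRel.compPow R m ∧ (y, z) ∈ CorrRel.compPow R n := by
  induction n generalizing z with
  | zero => simp [CorrRel.compPow, CorrRel.diag]
  | succ n ih =>
    constructor
    · rintro ⟨w, hxw, hwz⟩
      obtain ⟨y, hxy, hyw⟩ := (ih w).1 hxw
      exact ⟨y, hxy, w, hyw, hwz⟩
    · rintro ⟨y, hxy, w, hyw, hwz⟩
      exact ⟨w, (ih w).2 ⟨y, hxy, hyw⟩, hwz⟩

theorem CorrRel.mem_compPow_of_perm {X : Type*} {R : Set (X × X)} {σ : Equiv.Perm X}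
    (hσ : ∀ x, (x, σ x) ∈ R) (n : ℕ) (x : X) : (x, (σ ^ n) x) ∈ CorrRel.compPow R n := by
  induction n with
  | zero => simp [CorrRel.compPow, CorrRel.diag]
  | succ n ih => exact ⟨_, ih, by simpa [pow_succ'] using hσ ((σ ^ n) x)⟩

/-- For every essential relation R there is a positive integer m such that the m-fold
composition of R with itself is a preorder (reflexive and transitive). -/
theorem essential_pow_preorder {X : Type*} [Fintype X] (R : Set (X × X))
    (hR : CorrRel.Essential R) :
    ∃ m : ℕ, 0 < m ∧ (∀ x : X, (x, x) ∈ CorrRel.compPow R m) ∧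
      (∀ x y z : X, (x, y) ∈ CorrRel.compPow R m → (y, z) ∈ CorrRel.compPow R m →
        (x, z) ∈ CorrRel.compPow R m) := by
  obtain ⟨σ, hσ⟩ := hR.exists_perm
  have refl_pow : ∀ j x, (x, x) ∈ CorrRel.compPow R (orderOf σ * j) := fun j x => by
    simpa [pow_mul, pow_orderOf_eq_one] using CorrRel.mem_compPow_of_perm hσ (orderOf σ * j) x
  let chain : ℕ →o Set (X × X) :=
    ⟨fun j => CorrRel.compPow R (orderOf σ * j), monotone_nat_of_le_succ fun j => by
      rintro ⟨x, y⟩ h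
      rw [Nat.mul_add, CorrRel.mem_compPow_add]
      exact ⟨y, h, refl_pow 1 y⟩⟩
  obtain ⟨n, hn⟩ := WellFoundedGT.monotone_chain_condition chain
  refine ⟨orderOf σ * (n + 1), Nat.mul_pos (orderOf_pos σ) n.succ_pos, refl_pow _,
    fun x y z hxy hyz => ?_⟩
  have hxz := (CorrRel.mem_compPow_add R _ _ x z).2 ⟨y, hxy, hyz⟩
  rw [← Nat.mul_add] at hxz
  have heq : chain (n + 1 + (n + 1)) = chain (n + 1) :=
    (hn _ (by omega)).symm.trans (hn _ (by omega))
  exact heq.subset hxz
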